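/- (Lemma 2.12: unique radius of the isoenergetic curve in nonresonant directions.) For sufficiently large k (depending only on l, δ, b₁, b₂, C_W) the following holds, with γ₀ = 2l−2−4s₁−2δ. Let ν ∈ ℝ² with |ν| = 1 satisfy | |kν + p_m(0)|² − k² | > 2·k^{−4s₁−δ} for every m ∈ ℤ²∖{0}. Then for every α ∈ [0,1] there exists exactly one ϰ in the interval [k − k^{−1−4s₁−2δ}, k + k^{−1−4s₁−2δ}] such that k^{2l} is an eigenvalue of H_α(ϰν); moreover this ϰ satisfies |ϰ − k| ≤ C·k^{−1−4s₁−2γ₀−δ}, where C depends only on l, δ, b₁, b₂, C_W. -/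

import Mathlib

open Real Set

noncomputable section

/-- `s₁ = (2l-11)/32`. -/
def s1 (l : ℕ) : ℝ := (2 * (l : ℝ) - 11) / 32

/-- The dual-lattice point `p_m(0) = (2πm₁/a₁, 2πm₂/a₂)`. -/
def pvec (a₁ a₂ : ℝ) (m : ℤ × ℤ) : ℝ × ℝ := (2 * π * m.1 / a₁, 2 * π * m.2 / a₂)

/-- Squared Euclidean norm on `ℝ²`. -/
def sq2 (v : ℝ × ℝ) : ℝ := v.1 ^ 2 + v.2 ^ 2

/-- The bilinear square `|y|²_* = y₁² + y₂²` on `ℂ²` (no conjugation). -/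
def nsq (v : ℂ × ℂ) : ℂ := v.1 ^ 2 + v.2 ^ 2

/-- Complexification of a real vector. -/
def cx (x : ℝ × ℝ) : ℂ × ℂ := ((x.1 : ℂ), (x.2 : ℂ))

/-- Euclidean norm on `ℂ²`. -/
def cnorm (v : ℂ × ℂ) : ℝ := Real.sqrt (‖v.1‖ ^ 2 + ‖v.2‖ ^ 2)

/-- `γ₀ = 2l - 2 - 4s₁ - 2δ`. -/
def gam0 (l : ℕ) (δ : ℝ) : ℝ := 2 * (l : ℝ) - 2 - 4 * s1 l - 2 * δ

/-- A solution `f ∈ ℓ²(ℤ²)` of the eigenvalue equation with diagonal part `pw`,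
off-diagonal matrix `M` (acting by convolution) and spectral parameter `lam`;
the series involved are required to converge absolutely. -/
def IsSolution (pw : ℤ × ℤ → ℂ) (M : ℤ × ℤ → ℂ) (lam : ℂ) (f : ℤ × ℤ → ℂ) : Prop :=
  Memℓp f 2 ∧ (∀ m : ℤ × ℤ, Summable fun q : ℤ × ℤ => ‖M (m - q) * f q‖) ∧
    ∀ m : ℤ × ℤ, pw m * f m + ∑' q : ℤ × ℤ, M (m - q) * f q = lam * f m

/-- `lam` is an eigenvalue: there is a nonzero `ℓ²` solution. -/
def IsEigenvalue (pw : ℤ × ℤ → ℂ) (M : ℤ × ℤ → ℂ) (lam : ℂ) : Prop :=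
  ∃ f : ℤ × ℤ → ℂ, IsSolution pw M lam f ∧ f ≠ 0

/-- `lam` is a simple eigenvalue: the space of `ℓ²` solutions is one-dimensional. -/
def IsSimpleEigenvalue (pw : ℤ × ℤ → ℂ) (M : ℤ × ℤ → ℂ) (lam : ℂ) : Prop :=
  ∃ f : ℤ × ℤ → ℂ, IsSolution pw M lam f ∧ f ≠ 0 ∧
    ∀ g : ℤ × ℤ → ℂ, IsSolution pw M lam g → ∃ c : ℂ, g = c • f

/-- Fourier coefficients of a periodic function `W` on the cell `[0,a₁] × [0,a₂]`. -/
def fCoeff (a₁ a₂ : ℝ) (W : ℝ × ℝ → ℝ) (j : ℤ × ℤ) : ℂ :=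
  ((a₁ * a₂ : ℝ) : ℂ)⁻¹ *
    ∫ x in Icc (0 : ℝ × ℝ) (a₁, a₂),
      (W x : ℂ) *
        Complex.exp (-Complex.I * (((pvec a₁ a₂ j).1 * x.1 + (pvec a₁ a₂ j).2 * x.2 : ℝ) : ℂ))

open scoped ComplexConjugate ENNReal lp

section Abstract

variable {ι : Type*}

/-- The diagonal operator on `ℓ²` with bounded entries `c`. -/
def diagOp (c : ι → ℂ) (B : ℝ) (hc : ∀ m, ‖c m‖ ≤ B) : ℓ²(ι, ℂ) →L[ℂ] ℓ²(ι, ℂ) :=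
  LinearMap.mkContinuous
    { toFun := fun f => ⟨fun m => c m * f m,
        (((lp.memℓp f).norm).const_mul B).mono (fun m => by
          rw [norm_mul]
          exact mul_le_mul_of_nonneg_right (hc m) (norm_nonneg _))⟩
      map_add' := fun f g => by
        ext m
        exact mul_add (c m) (f m) (g m)
      map_smul' := fun a f => by
        ext m
        exact mul_left_comm (c m) a (f m) }
    (max B 0) (fun f => by
      have h2 : (2 : ℝ≥0∞) ≠ 0 := by norm_num
      calc _ ≤ ‖((max B 0 : ℝ) : ℂ) • f‖ := by
            refine lp.norm_mono (p := 2) h2 (fun m => ?_)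
            have : (((max B 0 : ℝ) : ℂ) • f) m = ((max B 0 : ℝ) : ℂ) * f m := rfl
            rw [this, norm_mul, Complex.norm_real, Real.norm_of_nonneg (le_max_right _ _)]
            change ‖c m * f m‖ ≤ _
            rw [norm_mul]
            exact mul_le_mul_of_nonneg_right ((hc m).trans (le_max_left _ _)) (norm_nonneg _)
        _ = _ := by
            rw [norm_smul, Complex.norm_real, Real.norm_of_nonneg (le_max_right _ _)])

theorem diagOp_apply (c : ι → ℂ) (B : ℝ) (hc : ∀ m, ‖c m‖ ≤ B) (f : ℓ²(ι, ℂ)) (m : ι) :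
    diagOp c B hc f m = c m * f m := rfl

theorem norm_diagOp_le (c : ι → ℂ) (B : ℝ) (hB : 0 ≤ B) (hc : ∀ m, ‖c m‖ ≤ B) :
    ‖diagOp c B hc‖ ≤ B := by
  refine (LinearMap.mkContinuous_norm_le _ (le_max_right _ _) _).trans ?_
  rw [max_eq_left hB]

variable [DecidableEq ι]

/-- If the diagonal dominates off the site `o`, the equations off `o` have a unique solution
up to scaling, close to the delta function at `o`. -/
theorem exists_reduced_solution (T : ℓ²(ι, ℂ) →L[ℂ] ℓ²(ι, ℂ)) (o : ι) (C R : ℝ)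
    (hC : 0 < C) (hT : ‖T‖ ≤ C) (hR : 2 * C ≤ R) (D : ι → ℝ) (hD : ∀ m, m ≠ o → R ≤ |D m|) :
    ∃ f : ℓ²(ι, ℂ), f o = 1 ∧ (∀ m, m ≠ o → (D m : ℂ) * f m + T f m = 0) ∧
      ‖f‖ ≤ 2 ∧ ‖f - lp.single 2 o 1‖ ≤ 2 * C / R ∧
      ∀ g : ℓ²(ι, ℂ), (∀ m, m ≠ o → (D m : ℂ) * g m + T g m = 0) → g = g o • f := by
  have hR0 : 0 < R := by linarith
  have hc : ∀ m, ‖(if m = o then (0 : ℂ) else ((D m)⁻¹ : ℝ))‖ ≤ R⁻¹ := by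
    intro m
    split_ifs with h
    · simp [hR0.le]
    · rw [Complex.norm_real, Real.norm_eq_abs, abs_inv]
      exact inv_anti₀ hR0 (hD m h)
  have hDne : ∀ m, m ≠ o → (D m : ℂ) ≠ 0 := by
    intro m hm h0
    have := hD m hm
    rw [Complex.ofReal_eq_zero.mp h0, abs_zero] at this
    linarith
  set A := diagOp _ R⁻¹ hc with hA
  have hAn : ‖A‖ ≤ R⁻¹ := norm_diagOp_le _ _ (inv_nonneg.mpr hR0.le) hc
  have hKn : ‖A * T‖ ≤ C / R := by
    calc ‖A * T‖ ≤ ‖A‖ * ‖T‖ := norm_mul_le _ _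
      _ ≤ R⁻¹ * C := by gcongr
      _ = C / R := by ring
  have hCR : C / R ≤ 1 / 2 := by rw [div_le_div_iff₀ hR0 two_pos]; linarith
  have hAT : ∀ (g : ℓ²(ι, ℂ)) m, (A * T) g m =
      (if m = o then (0 : ℂ) else ((D m)⁻¹ : ℝ)) * T g m := fun g m => rfl
  have hlt : ‖-(A * T)‖ < 1 := by rw [norm_neg]; linarith
  set U := Units.oneSub (-(A * T)) hlt with hU
  have hUv : ∀ g, (U : ℓ²(ι, ℂ) →L[ℂ] ℓ²(ι, ℂ)) g = g + (A * T) g := by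
    intro g
    simp [hU]
  have hinv : ∀ g, (U : ℓ²(ι, ℂ) →L[ℂ] ℓ²(ι, ℂ)) ((↑U⁻¹ : ℓ²(ι, ℂ) →L[ℂ] ℓ²(ι, ℂ)) g) = g := by
    intro g
    rw [← mul_apply_eq_comp, Units.mul_inv, one_apply_eq_self]
  have hinv' : ∀ g, (↑U⁻¹ : ℓ²(ι, ℂ) →L[ℂ] ℓ²(ι, ℂ)) ((U : ℓ²(ι, ℂ) →L[ℂ] ℓ²(ι, ℂ)) g) = g := by
    intro g
    rw [← mul_apply_eq_comp, Units.inv_mul, one_apply_eq_self]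
  set e : ℓ²(ι, ℂ) := lp.single 2 o 1 with he
  have heo : e o = 1 := lp.single_apply_self _ _ _
  have hen : ‖e‖ = 1 := by rw [he, lp.norm_single (by norm_num)]; simp
  set f := (↑U⁻¹ : ℓ²(ι, ℂ) →L[ℂ] ℓ²(ι, ℂ)) e with hf
  have hfe : f + (A * T) f = e := by rw [← hUv, hf, hinv]
  have hfm : ∀ m, f m + (A * T) f m = e m := fun m => by rw [← hfe]; rfl
  have hsub : f - e = -((A * T) f) := by rw [← hfe]; abel
  have hsubn : ‖f - e‖ ≤ C / R * ‖f‖ := by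
    rw [hsub, norm_neg]
    exact (ContinuousLinearMap.le_opNorm _ _).trans (by gcongr)
  have hfn : ‖f‖ ≤ 2 := by
    have h1 : ‖f‖ ≤ ‖f - e‖ + ‖e‖ := by simpa using norm_add_le (f - e) e
    have : C / R * ‖f‖ ≤ 1 / 2 * ‖f‖ := by gcongr
    linarith
  refine ⟨f, ?_, ?_, hfn, ?_, ?_⟩
  · have := hfm o
    rw [hAT, if_pos rfl, zero_mul, add_zero, heo] at this
    exact this
  · intro m hm
    have := hfm m
    rw [hAT, if_neg hm, lp.single_apply_ne _ _ _ hm] at this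
    have h2 := congrArg (fun z => (D m : ℂ) * z) this
    simp only [mul_add, mul_zero] at h2
    rw [← mul_assoc, Complex.ofReal_inv, mul_inv_cancel₀ (hDne m hm), one_mul] at h2
    exact h2
  · refine hsubn.trans ?_
    calc C / R * ‖f‖ ≤ C / R * 2 := by gcongr
      _ = 2 * C / R := by ring
  · intro g hg
    have : (U : ℓ²(ι, ℂ) →L[ℂ] ℓ²(ι, ℂ)) g = g o • e := by
      rw [hUv]
      ext m
      change g m + (A * T) g m = g o * e m
      rw [hAT]
      by_cases hm : m = o
      · subst hm; rw [if_pos rfl, heo]; simp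
      · rw [if_neg hm, lp.single_apply_ne _ _ _ hm, mul_zero]
        have h3 := hg m hm
        have h4 : T g m = -((D m : ℂ) * g m) := by linear_combination h3
        rw [h4, Complex.ofReal_inv, mul_neg, ← mul_assoc, inv_mul_cancel₀ (hDne m hm)]
        ring
    calc g = (↑U⁻¹ : ℓ²(ι, ℂ) →L[ℂ] ℓ²(ι, ℂ)) ((U : ℓ²(ι, ℂ) →L[ℂ] ℓ²(ι, ℂ)) g) := (hinv' g).symm
      _ = g o • f := by rw [this, map_smul]

/-- Comparison of the residuals at `o` for two different diagonals. -/
theorem norm_residual_sub_le (T : ℓ²(ι, ℂ) →L[ℂ] ℓ²(ι, ℂ)) (o : ι)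
    (hsym : ∀ f g, inner ℂ (T f) g = inner ℂ f (T g)) (D D' : ι → ℝ) (f f' : ℓ²(ι, ℂ))
    (hfo : f o = 1) (hfo' : f' o = 1)
    (hf : ∀ m, m ≠ o → (D m : ℂ) * f m + T f m = 0)
    (hf' : ∀ m, m ≠ o → (D' m : ℂ) * f' m + T f' m = 0)
    (L : ℝ) (hL : 0 ≤ L) (hDD : ∀ m, m ≠ o → |D' m - D m| ≤ L * |D m|) :
    ‖(T f o - conj (T f' o))‖ ≤ L * (‖f' - lp.single 2 o 1‖ * ‖T f‖) := by
  set g := f' - lp.single 2 o 1 with hg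
  have hgm : ∀ m, m ≠ o → g m = f' m := by
    intro m hm
    change f' m - (lp.single 2 o 1 : ℓ²(ι, ℂ)) m = f' m
    rw [lp.single_apply_ne _ _ _ hm, sub_zero]
  set z : ι → ℂ := fun m => inner ℂ (f' m) (T f m) - inner ℂ (T f' m) (f m) with hz
  have hzs : HasSum z 0 := by
    have h1 := (lp.hasSum_inner (𝕜 := ℂ) f' (T f)).sub (lp.hasSum_inner (𝕜 := ℂ) (T f') f)
    rw [hsym, sub_self] at h1
    exact h1
  have hbound : ∀ m, m ≠ o → ‖z m‖ ≤ L * (‖g m‖ * ‖T f m‖) := by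
    intro m hm
    have e1 : T f m = -((D m : ℂ) * f m) := by linear_combination hf m hm
    have e2 : T f' m = -((D' m : ℂ) * f' m) := by linear_combination hf' m hm
    have : z m = conj (f' m) * f m * ((D' m - D m : ℝ) : ℂ) := by
      simp only [hz, RCLike.inner_apply, e1, e2, map_neg, map_mul, Complex.conj_ofReal]
      push_cast
      ring
    rw [this, e1, hgm m hm, norm_neg, norm_mul, norm_mul, norm_mul, Complex.norm_real,
      Complex.norm_real, RCLike.norm_conj, Real.norm_eq_abs, Real.norm_eq_abs]
    calc ‖f' m‖ * ‖f m‖ * |D' m - D m| ≤ ‖f' m‖ * ‖f m‖ * (L * |D m|) := by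
          gcongr; exact hDD m hm
      _ = _ := by ring
  have hconj : (2 : ℝ≥0∞).toReal.HolderConjugate (2 : ℝ≥0∞).toReal := by
    rw [Real.holderConjugate_iff]; norm_num
  have hsum := (lp.summable_mul hconj g (T f)).mul_left L
  have hle := mul_le_mul_of_nonneg_left (lp.tsum_mul_le_mul_norm' hconj g (T f)) hL
  rw [← tsum_mul_left] at hle
  have hzo : z o = T f o - conj (T f' o) := by
    simp [hz, hfo, hfo']
  have hsplit := hzs.summable.tsum_eq_add_tsum_ite o
  rw [hzs.tsum_eq] at hsplit
  have hzo' : z o = -∑' m, (if m = o then 0 else z m) := by linear_combination -hsplit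
  rw [← hzo, hzo', norm_neg]
  refine (tsum_of_norm_bounded hsum.hasSum ?_).trans hle
  intro m
  split_ifs with h
  · simp; positivity
  · exact hbound m h

end Abstract

section Fourier

open MeasureTheory

/-- Compression of a symmetric operator to the span of an orthonormal family, written
as an operator on `ℓ²`. -/
theorem exists_compression {ι H : Type*} [DecidableEq ι] [NormedAddCommGroup H]
    [InnerProductSpace ℂ H] [CompleteSpace H] (v : ι → H) (hv : Orthonormal ℂ v) (M : H →L[ℂ] H)
    (hM : ∀ x y, inner ℂ (M x) y = inner ℂ x (M y)) :
    ∃ T : ℓ²(ι, ℂ) →L[ℂ] ℓ²(ι, ℂ), ‖T‖ ≤ ‖M‖ ∧ (∀ f g, inner ℂ (T f) g = inner ℂ f (T g)) ∧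
      ∀ f m, HasSum (fun q => inner ℂ (v m) (M (v q)) * f q) (T f m) := by
  have hV := hv.orthogonalFamily
  set J : ℓ²(ι, ℂ) →L[ℂ] H := hV.linearIsometry.toContinuousLinearMap with hJ
  have hJn : ‖J‖ ≤ 1 := hV.linearIsometry.norm_toContinuousLinearMap_le
  have hJ' : ‖ContinuousLinearMap.adjoint J‖ ≤ 1 := by rwa [LinearIsometryEquiv.norm_map]
  refine ⟨(ContinuousLinearMap.adjoint J).comp (M.comp J), ?_, ?_, ?_⟩
  · calc _ ≤ ‖ContinuousLinearMap.adjoint J‖ * ‖M.comp J‖ := ContinuousLinearMap.opNorm_comp_le _ _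
      _ ≤ ‖ContinuousLinearMap.adjoint J‖ * (‖M‖ * ‖J‖) := by
          gcongr; exact ContinuousLinearMap.opNorm_comp_le _ _
      _ ≤ 1 * (‖M‖ * 1) := by gcongr
      _ = ‖M‖ := by ring
  · intro f g
    simp only [ContinuousLinearMap.comp_apply, ContinuousLinearMap.adjoint_inner_left,
      ContinuousLinearMap.adjoint_inner_right, hM]
  · intro f m
    have h1 : inner ℂ (lp.single 2 m (1 : ℂ) : ℓ²(ι, ℂ))
        (((ContinuousLinearMap.adjoint J).comp (M.comp J)) f)
        = ((ContinuousLinearMap.adjoint J).comp (M.comp J)) f m := by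
      rw [lp.inner_single_left]; simp
    have h2 : J (lp.single 2 m (1 : ℂ)) = v m := by
      simp [hJ]
    rw [← h1, ContinuousLinearMap.comp_apply, ContinuousLinearMap.adjoint_inner_right, h2]
    have h3 := (hV.hasSum_linearIsometry f).mapL ((innerSL ℂ (v m)).comp M)
    have h4 : (fun q => inner ℂ (v m) (M (v q)) * f q) = fun q => ((innerSL ℂ (v m)).comp M)
        (LinearIsometry.toSpanSingleton ℂ H (hv.1 q) (f q)) := by
      ext q
      simp [mul_comm]
    rw [h4]
    exact h3

/-- Multiplication by a bounded real function on `L²`. -/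
theorem exists_multiplication {α : Type*} [MeasurableSpace α] (μ : Measure α) [IsFiniteMeasure μ]
    (φ : α → ℝ) (hφ : Measurable φ) (C : ℝ) (hC : ∀ x, |φ x| ≤ C) (hC0 : 0 ≤ C) :
    ∃ M : Lp ℂ 2 μ →L[ℂ] Lp ℂ 2 μ, ‖M‖ ≤ C ∧ (∀ x y, inner ℂ (M x) y = inner ℂ x (M y)) ∧
      ∀ x, M x =ᵐ[μ] fun a => (φ a : ℂ) * x a := by
  have hm : MemLp (fun a => (φ a : ℂ)) ∞ μ :=
    memLp_top_of_bound (Complex.measurable_ofReal.comp hφ).aestronglyMeasurable C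
      (Filter.Eventually.of_forall fun x => by simpa using hC x)
  set F : Lp ℂ ∞ μ := hm.toLp _ with hF
  have hFn : ‖F‖ ≤ C := by
    rw [hF, Lp.norm_toLp]
    refine ENNReal.toReal_le_of_le_ofReal hC0 ?_
    rw [eLpNorm_exponent_top]
    exact eLpNormEssSup_le_of_ae_bound
      (Filter.Eventually.of_forall fun x => by simpa using hC x)
  have hae : ∀ x : Lp ℂ 2 μ, (ContinuousLinearMap.mul ℂ ℂ).holderL μ ∞ 2 2 F x
      =ᵐ[μ] fun a => (φ a : ℂ) * x a := by
    intro x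
    have h1 := (ContinuousLinearMap.mul ℂ ℂ).coeFn_holder (r := 2) F x
    filter_upwards [h1, hm.coeFn_toLp] with a ha hb
    change ((ContinuousLinearMap.mul ℂ ℂ).holder 2 F x) a = _
    rw [ha, ← hb]
    rfl
  refine ⟨(ContinuousLinearMap.mul ℂ ℂ).holderL μ ∞ 2 2 F, ?_, ?_, hae⟩
  · calc _ ≤ ‖(ContinuousLinearMap.mul ℂ ℂ).holderL μ ∞ 2 2‖ * ‖F‖ :=
          ContinuousLinearMap.le_opNorm _ _
      _ ≤ 1 * C := by
          gcongr
          exact (ContinuousLinearMap.norm_holderL_le _).trans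
            (ContinuousLinearMap.opNorm_mul_le ℂ ℂ)
      _ = C := one_mul _
  · intro x y
    rw [L2.inner_def, L2.inner_def]
    refine integral_congr_ae ?_
    filter_upwards [hae x, hae y] with a ha hb
    rw [ha, hb]
    simp only [RCLike.inner_apply, map_mul, Complex.conj_ofReal]
    ring

/-- Plane waves. -/
def planeWave (a₁ a₂ : ℝ) (m : ℤ × ℤ) (x : ℝ × ℝ) : ℂ :=
  Complex.exp (Complex.I * (((pvec a₁ a₂ m).1 * x.1 + (pvec a₁ a₂ m).2 * x.2 : ℝ) : ℂ))

theorem continuous_planeWave (a₁ a₂ : ℝ) (m : ℤ × ℤ) : Continuous (planeWave a₁ a₂ m) := by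
  unfold planeWave
  fun_prop

theorem norm_planeWave (a₁ a₂ : ℝ) (m : ℤ × ℤ) (x : ℝ × ℝ) : ‖planeWave a₁ a₂ m x‖ = 1 := by
  rw [planeWave, mul_comm, Complex.norm_exp_ofReal_mul_I]

theorem conj_planeWave_mul (a₁ a₂ : ℝ) (m q : ℤ × ℤ) (x : ℝ × ℝ) :
    conj (planeWave a₁ a₂ m x) * planeWave a₁ a₂ q x =
      Complex.exp (-Complex.I *
        (((pvec a₁ a₂ (m - q)).1 * x.1 + (pvec a₁ a₂ (m - q)).2 * x.2 : ℝ) : ℂ)) := by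
  rw [planeWave, planeWave, ← Complex.exp_conj, ← Complex.exp_add]
  congr 1
  simp only [map_mul, Complex.conj_I, Complex.conj_ofReal, pvec, Prod.fst_sub, Prod.snd_sub]
  push_cast
  ring

theorem integral_exp_period (a : ℝ) (ha : 0 < a) (n : ℤ) :
    ∫ x in Icc (0 : ℝ) a, Complex.exp (-Complex.I * ((2 * π * n / a * x : ℝ) : ℂ)) =
      if n = 0 then (a : ℂ) else 0 := by
  rw [integral_Icc_eq_integral_Ioc, ← intervalIntegral.integral_of_le ha.le]
  split_ifs with h
  · simp [h]
  · have hc : (-Complex.I * (2 * π * n / a : ℝ) : ℂ) ≠ 0 := by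
      simp [h, ha.ne', Real.pi_ne_zero]
    have := integral_exp_mul_complex (a := 0) (b := a) hc
    rw [show (fun x : ℝ => Complex.exp (-Complex.I * ((2 * π * n / a * x : ℝ) : ℂ))) =
      fun x : ℝ => Complex.exp ((-Complex.I * (2 * π * n / a : ℝ) : ℂ) * x) by
        ext x; push_cast; ring_nf, this]
    have ha' : (a : ℂ) ≠ 0 := by exact_mod_cast ha.ne'
    have e1 : (-Complex.I * (2 * π * n / a : ℝ) : ℂ) * a = (-n : ℤ) * (2 * π * Complex.I) := by
      push_cast
      field_simp
    rw [e1, Complex.exp_int_mul_two_pi_mul_I]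
    simp

theorem integral_planeWave (a₁ a₂ : ℝ) (h₁ : 0 < a₁) (h₂ : 0 < a₂) (m : ℤ × ℤ) :
    ∫ x in Icc (0 : ℝ × ℝ) (a₁, a₂), Complex.exp (-Complex.I *
        (((pvec a₁ a₂ m).1 * x.1 + (pvec a₁ a₂ m).2 * x.2 : ℝ) : ℂ)) =
      if m = 0 then ((a₁ * a₂ : ℝ) : ℂ) else 0 := by
  have h := setIntegral_prod_mul (μ := (volume : Measure ℝ)) (ν := (volume : Measure ℝ))
    (fun x => Complex.exp (-Complex.I * ((2 * π * m.1 / a₁ * x : ℝ) : ℂ)))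
    (fun x => Complex.exp (-Complex.I * ((2 * π * m.2 / a₂ * x : ℝ) : ℂ)))
    (Icc 0 a₁) (Icc 0 a₂)
  rw [integral_exp_period a₁ h₁, integral_exp_period a₂ h₂, Icc_prod_Icc] at h
  rw [Measure.volume_eq_prod]
  refine Eq.trans ?_ (h.trans ?_)
  · congr 1
    ext x
    rw [← Complex.exp_add]
    congr 1
    simp only [pvec]
    push_cast
    ring
  · rcases m with ⟨m₁, m₂⟩
    by_cases e1 : m₁ = 0 <;> by_cases e2 : m₂ = 0 <;> simp [e1, e2]

/-- Convolution with the Fourier coefficients of a bounded real function is a bounded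
symmetric operator on `ℓ²`. -/
theorem exists_convolution (a₁ a₂ : ℝ) (h₁ : 0 < a₁) (h₂ : 0 < a₂) (W : ℝ × ℝ → ℝ)
    (hW : Measurable W) (C : ℝ) (hC : ∀ x, |W x| ≤ C) :
    ∃ T : ℓ²(ℤ × ℤ, ℂ) →L[ℂ] ℓ²(ℤ × ℤ, ℂ), ‖T‖ ≤ C ∧
      (∀ f g, inner ℂ (T f) g = inner ℂ f (T g)) ∧
      ∀ f m, HasSum (fun q => fCoeff a₁ a₂ W (m - q) * f q) (T f m) := by
  have hC0 : 0 ≤ C := (abs_nonneg _).trans (hC 0)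
  set μ : Measure (ℝ × ℝ) := ENNReal.ofReal (a₁ * a₂)⁻¹ •
    (volume.restrict (Icc (0 : ℝ × ℝ) (a₁, a₂))) with hμ
  have hfin : IsFiniteMeasure (volume.restrict (Icc (0 : ℝ × ℝ) (a₁, a₂))) :=
    ⟨by rw [Measure.restrict_apply_univ]; exact isCompact_Icc.measure_lt_top⟩
  have hfin' : IsFiniteMeasure μ := Measure.smul_finite _ ENNReal.ofReal_ne_top
  have ha : 0 < a₁ * a₂ := mul_pos h₁ h₂
  have hint : ∀ g : ℝ × ℝ → ℂ, ∫ x, g x ∂μ =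
      ((a₁ * a₂ : ℝ) : ℂ)⁻¹ * ∫ x in Icc (0 : ℝ × ℝ) (a₁, a₂), g x := by
    intro g
    rw [hμ, integral_smul_measure, ENNReal.toReal_ofReal (inv_nonneg.mpr ha.le),
      Complex.real_smul, Complex.ofReal_inv]
  have hmem : ∀ m, MemLp (planeWave a₁ a₂ m) 2 μ := fun m =>
    MemLp.of_bound (continuous_planeWave a₁ a₂ m).aestronglyMeasurable 1
      (Filter.Eventually.of_forall fun x => (norm_planeWave a₁ a₂ m x).le)
  set v : ℤ × ℤ → Lp ℂ 2 μ := fun m => (hmem m).toLp _ with hvdef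
  have hv : Orthonormal ℂ v := by
    rw [orthonormal_iff_ite]
    intro m q
    have : inner ℂ (v m) (v q) = ∫ x, Complex.exp (-Complex.I *
        (((pvec a₁ a₂ (m - q)).1 * x.1 + (pvec a₁ a₂ (m - q)).2 * x.2 : ℝ) : ℂ)) ∂μ := by
      rw [L2.inner_def]
      refine integral_congr_ae ?_
      filter_upwards [(hmem m).coeFn_toLp, (hmem q).coeFn_toLp] with x hx hy
      rw [hvdef]
      simp only
      rw [hx, hy, RCLike.inner_apply, ← conj_planeWave_mul, mul_comm]
    rw [this, hint, integral_planeWave a₁ a₂ h₁ h₂]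
    have ha' : ((a₁ * a₂ : ℝ) : ℂ) ≠ 0 := by exact_mod_cast ha.ne'
    by_cases h : m = q
    · rw [if_pos h, if_pos (sub_eq_zero.mpr h), inv_mul_cancel₀ ha']
    · rw [if_neg h, if_neg (fun h' => h (sub_eq_zero.mp h')), mul_zero]
  obtain ⟨M, hMn, hMs, hMa⟩ := exists_multiplication μ W hW C hC hC0
  obtain ⟨T, hTn, hTs, hTa⟩ := exists_compression v hv M hMs
  refine ⟨T, hTn.trans hMn, hTs, fun f m => ?_⟩
  have hcoef : ∀ q, inner ℂ (v m) (M (v q)) = fCoeff a₁ a₂ W (m - q) := by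
    intro q
    rw [L2.inner_def, fCoeff, ← hint]
    refine integral_congr_ae ?_
    filter_upwards [(hmem m).coeFn_toLp, (hmem q).coeFn_toLp, hMa (v q)] with x hx hy hz
    rw [hz]
    rw [hvdef]
    simp only
    rw [hx, hy, RCLike.inner_apply, ← conj_planeWave_mul]
    ring
  have := hTa f m
  simp only [hcoef] at this
  exact this

theorem fCoeff_zero (a₁ a₂ : ℝ) (W : ℝ × ℝ → ℝ)
    (hW : (∫ x in Icc (0 : ℝ × ℝ) (a₁, a₂), W x) = 0) : fCoeff a₁ a₂ W 0 = 0 := by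
  have : fCoeff a₁ a₂ W 0 =
      ((a₁ * a₂ : ℝ) : ℂ)⁻¹ * ∫ x in Icc (0 : ℝ × ℝ) (a₁, a₂), (W x : ℂ) := by
    simp [fCoeff, pvec]
  rw [this, integral_complex_ofReal, hW]
  simp

/-- The scaled convolution operator, with vanishing entry at the origin for mean-zero `W`. -/
theorem exists_scaled_convolution (a₁ a₂ : ℝ) (h₁ : 0 < a₁) (h₂ : 0 < a₂) (W : ℝ × ℝ → ℝ)
    (hW : Measurable W) (C : ℝ) (hC : ∀ x, |W x| ≤ C)
    (hW0 : (∫ x in Icc (0 : ℝ × ℝ) (a₁, a₂), W x) = 0) (α : ℝ) (hα : α ∈ Icc (0 : ℝ) 1) :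
    ∃ T : ℓ²(ℤ × ℤ, ℂ) →L[ℂ] ℓ²(ℤ × ℤ, ℂ), ‖T‖ ≤ C ∧
      (∀ f g, inner ℂ (T f) g = inner ℂ f (T g)) ∧
      (∀ f m, HasSum (fun q => (α : ℂ) * fCoeff a₁ a₂ W (m - q) * f q) (T f m)) ∧
      T (lp.single 2 0 1) 0 = 0 := by
  obtain ⟨T₀, hT₀n, hT₀s, hT₀⟩ := exists_convolution a₁ a₂ h₁ h₂ W hW C hC
  have hTsum : ∀ f m, HasSum (fun q => (α : ℂ) * fCoeff a₁ a₂ W (m - q) * f q)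
      (((α : ℂ) • T₀) f m) := by
    intro f m
    have h := (hT₀ f m).mul_left (α : ℂ)
    simp only [← mul_assoc] at h
    exact h
  refine ⟨(α : ℂ) • T₀, ?_, ?_, hTsum, ?_⟩
  · rw [norm_smul, Complex.norm_real, Real.norm_of_nonneg hα.1]
    exact (mul_le_of_le_one_left (norm_nonneg _) hα.2).trans hT₀n
  · intro f g
    simp only [smul_apply, inner_smul_left, inner_smul_right, Complex.conj_ofReal, hT₀s]
  · refine (hTsum _ _).unique ?_
    convert! (hasSum_zero : HasSum (fun _ : ℤ × ℤ => (0 : ℂ)) 0) using 1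
    ext q
    by_cases hq : q = 0
    · subst hq
      simp [fCoeff_zero a₁ a₂ W hW0]
    · rw [lp.single_apply_ne _ _ _ hq, mul_zero]

end Fourier

section RealEstimates

theorem exists_unique_perturbed_root (q : ℕ) (k ρ η ε : ℝ) (hρ : 0 < ρ) (hρk : ρ ≤ k / 2)
    (G : ℝ → ℝ)
    (hG : ∀ x ∈ Icc (k - ρ) (k + ρ), ∀ y ∈ Icc (k - ρ) (k + ρ), |G x - G y| ≤ η * |x - y|)
    (hη : η < (k / 2) ^ q) (hGε : ∀ x ∈ Icc (k - ρ) (k + ρ), |G x| ≤ ε) (hε : ε < ρ * k ^ q) :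
    ∃ κ ∈ Icc (k - ρ) (k + ρ), κ ^ (q + 1) - k ^ (q + 1) + G κ = 0 ∧ |κ - k| * k ^ q ≤ ε ∧
      ∀ κ' ∈ Icc (k - ρ) (k + ρ), κ' ^ (q + 1) - k ^ (q + 1) + G κ' = 0 → κ' = κ := by
  have hk : 0 < k := by linarith
  have low : ∀ x y : ℝ, 0 ≤ x → x ≤ y → (y - x) * y ^ q ≤ y ^ (q + 1) - x ^ (q + 1) := by
    intro x y hx hxy
    have := mul_le_mul_of_nonneg_left (pow_le_pow_left₀ hx hxy q) hx
    rw [pow_succ, pow_succ]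
    nlinarith
  have hcont : ContinuousOn (fun x => x ^ (q + 1) - k ^ (q + 1) + G x) (Icc (k - ρ) (k + ρ)) := by
    refine ContinuousOn.add (by fun_prop) ?_
    have : LipschitzOnWith (Real.toNNReal η) G (Icc (k - ρ) (k + ρ)) := by
      refine LipschitzOnWith.of_dist_le_mul fun x hx y hy => ?_
      rw [Real.dist_eq, Real.dist_eq]
      exact (hG x hx y hy).trans (mul_le_mul_of_nonneg_right (Real.le_coe_toNNReal η)
        (abs_nonneg _))
    exact this.continuousOn
  have hl : k - ρ ∈ Icc (k - ρ) (k + ρ) := ⟨le_rfl, by linarith⟩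
  have hr : k + ρ ∈ Icc (k - ρ) (k + ρ) := ⟨by linarith, le_rfl⟩
  have hleft : (k - ρ) ^ (q + 1) - k ^ (q + 1) + G (k - ρ) ≤ 0 := by
    have h1 := low (k - ρ) k (by linarith) (by linarith)
    have h2 := (abs_le.mp (hGε _ hl)).2
    rw [sub_sub_cancel] at h1
    linarith
  have hright : 0 ≤ (k + ρ) ^ (q + 1) - k ^ (q + 1) + G (k + ρ) := by
    have h1 := low k (k + ρ) hk.le (by linarith)
    have h2 := (abs_le.mp (hGε _ hr)).1
    have h3 : ρ * k ^ q ≤ ρ * (k + ρ) ^ q := by gcongr; linarith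
    rw [add_sub_cancel_left] at h1
    linarith
  obtain ⟨κ, hκ, hκ0⟩ := intermediate_value_Icc (by linarith) hcont ⟨hleft, hright⟩
  refine ⟨κ, hκ, hκ0, ?_, ?_⟩
  · have h0 : κ ^ (q + 1) - k ^ (q + 1) + G κ = 0 := hκ0
    have h2 := abs_le.mp (hGε κ hκ)
    rcases le_total κ k with h | h
    · have := low κ k (by linarith [hκ.1]) h
      rw [abs_of_nonpos (by linarith)]
      linarith [h2.2]
    · have h1 := low k κ hk.le h
      have h3 : (κ - k) * k ^ q ≤ (κ - k) * κ ^ q := by gcongr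
      rw [abs_of_nonneg (by linarith)]
      linarith [h2.1]
  · have key : ∀ x ∈ Icc (k - ρ) (k + ρ), ∀ y ∈ Icc (k - ρ) (k + ρ), x < y →
        x ^ (q + 1) - k ^ (q + 1) + G x = 0 → y ^ (q + 1) - k ^ (q + 1) + G y = 0 → False := by
      intro x hx y hy hxy h1 h2
      have h3 := low x y (by linarith [hx.1]) hxy.le
      have h4 := (abs_le.mp (hG x hx y hy)).2
      rw [abs_of_neg (by linarith)] at h4
      have h5 : (k / 2) ^ q ≤ y ^ q := by
        gcongr
        linarith [hy.1]
      have h6 : (y - x) * η < (y - x) * y ^ q := by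
        apply mul_lt_mul_of_pos_left <;> linarith
      linarith
    intro κ' hκ' h'
    rcases lt_trichotomy κ' κ with h | h | h
    · exact (key κ' hκ' κ hκ h h' hκ0).elim
    · exact h
    · exact (key κ hκ κ' hκ' h hκ0 h').elim

theorem abs_sub_mul_pow_le (n : ℕ) (x y : ℝ) (hx : 0 ≤ x) (hy : 0 ≤ y) :
    |x - y| * (max x y) ^ n ≤ |x ^ (n + 1) - y ^ (n + 1)| := by
  have low : ∀ x y : ℝ, 0 ≤ x → x ≤ y → (y - x) * y ^ n ≤ y ^ (n + 1) - x ^ (n + 1) := by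
    intro x y hx hxy
    have := mul_le_mul_of_nonneg_left (pow_le_pow_left₀ hx hxy n) hx
    rw [pow_succ, pow_succ]
    nlinarith
  rcases le_total x y with h | h
  · rw [max_eq_right h, abs_sub_comm, abs_of_nonneg (by linarith), abs_sub_comm]
    exact (low x y hx h).trans (le_abs_self _)
  · rw [max_eq_left h, abs_of_nonneg (by linarith)]
    exact (low y x hy h).trans (le_abs_self _)

variable {k τ A e t : ℝ}

/-- Common size estimates: `N` is the larger of `k` and `√(A² + e²)`. -/
theorem exists_scale (hk : 1 ≤ k) (ht : |t| ≤ 1) :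
    ∃ N : ℝ, k ≤ N ∧ max (A ^ 2 + e ^ 2) (k ^ 2) = N ^ 2 ∧
      |((A + t) ^ 2 + e ^ 2) - (A ^ 2 + e ^ 2)| ≤ 3 * N * |t| ∧
      (2 * k < N → 3 / 2 * N ≤ |A ^ 2 + e ^ 2 - k ^ 2|) := by
  have h0 : 0 ≤ max (A ^ 2 + e ^ 2) (k ^ 2) := le_max_of_le_right (sq_nonneg k)
  set N := √(max (A ^ 2 + e ^ 2) (k ^ 2)) with hN
  have hN2 : N ^ 2 = max (A ^ 2 + e ^ 2) (k ^ 2) := Real.sq_sqrt h0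
  have hN0 : 0 ≤ N := Real.sqrt_nonneg _
  have hkN : k ≤ N := by
    refine Real.le_sqrt_of_sq_le (le_max_right _ _)
  have hA : |A| ≤ N := by
    refine Real.le_sqrt_of_sq_le ?_
    rw [sq_abs]
    exact le_max_of_le_left (by nlinarith [sq_nonneg e])
  refine ⟨N, hkN, hN2.symm, ?_, ?_⟩
  · have : ((A + t) ^ 2 + e ^ 2) - (A ^ 2 + e ^ 2) = (2 * A + t) * t := by ring
    rw [this, abs_mul]
    gcongr
    calc |2 * A + t| ≤ |2 * A| + |t| := abs_add_le _ _
      _ = 2 * |A| + |t| := by rw [abs_mul, abs_two]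
      _ ≤ 3 * N := by linarith
  · intro h
    have h1 : k ^ 2 < N ^ 2 := by nlinarith
    have h2 : A ^ 2 + e ^ 2 = N ^ 2 := by
      rcases max_choice (A ^ 2 + e ^ 2) (k ^ 2) with h3 | h3
      · rw [hN2, h3]
      · rw [hN2, h3] at h1
        exact absurd h1 (lt_irrefl _)
    rw [h2]
    refine le_trans ?_ (le_abs_self _)
    nlinarith

theorem le_abs_shift (hk : 1 ≤ k) (hτ1 : τ ≤ 1) (ht : 6 * k * |t| ≤ τ)
    (h : 2 * τ < |A ^ 2 + e ^ 2 - k ^ 2|) : τ ≤ |(A + t) ^ 2 + e ^ 2 - k ^ 2| := by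
  have ht1 : 6 * |t| ≤ 1 := by nlinarith [abs_nonneg t]
  obtain ⟨N, hkN, -, h1, h2⟩ := exists_scale (A := A) (e := e) (t := t) hk
    (by linarith [abs_nonneg t])
  have h3 : |A ^ 2 + e ^ 2 - k ^ 2| ≤
      |(A + t) ^ 2 + e ^ 2 - k ^ 2| + |((A + t) ^ 2 + e ^ 2) - (A ^ 2 + e ^ 2)| := by
    rw [abs_sub_comm ((A + t) ^ 2 + e ^ 2) (A ^ 2 + e ^ 2),
      add_comm (|(A + t) ^ 2 + e ^ 2 - k ^ 2|)]
    exact abs_sub_le (A ^ 2 + e ^ 2) ((A + t) ^ 2 + e ^ 2) (k ^ 2)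
  rcases le_or_gt N (2 * k) with h4 | h4
  · have : 3 * N * |t| ≤ 3 * (2 * k) * |t| := by gcongr
    linarith
  · have := h2 h4
    have : 3 * N * |t| ≤ N / 2 := by nlinarith
    linarith

theorem abs_pow_shift_sub_le (n : ℕ) (hk : 1 ≤ k) (hτ : 0 < τ) (hτ1 : τ ≤ 1) (ht : |t| ≤ 1)
    (h : τ ≤ |A ^ 2 + e ^ 2 - k ^ 2|) :
    |((A + t) ^ 2 + e ^ 2) ^ (n + 1) - (A ^ 2 + e ^ 2) ^ (n + 1)| ≤
      (6 * (n + 1) * 4 ^ n * (k / τ) * |t|) * |(A ^ 2 + e ^ 2) ^ (n + 1) - (k ^ 2) ^ (n + 1)| := by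
  obtain ⟨N, hkN, hmax, h1, h2⟩ := exists_scale (A := A) (e := e) (t := t) hk ht
  have hN0 : 0 < N := by linarith
  have hx : 0 ≤ A ^ 2 + e ^ 2 := by positivity
  have hx' : 0 ≤ (A + t) ^ 2 + e ^ 2 := by positivity
  have hxN : A ^ 2 + e ^ 2 ≤ N ^ 2 := hmax ▸ le_max_left _ _
  have hxN' : (A + t) ^ 2 + e ^ 2 ≤ 4 * N ^ 2 := by
    have := (abs_le.mp h1).2
    nlinarith [abs_nonneg t]
  have hlow := abs_sub_mul_pow_le n _ (k ^ 2) hx (sq_nonneg k)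
  rw [hmax] at hlow
  have hup := abs_pow_sub_pow_le ((A + t) ^ 2 + e ^ 2) (A ^ 2 + e ^ 2) (n + 1)
  rw [abs_of_nonneg hx, abs_of_nonneg hx', Nat.add_sub_cancel] at hup
  have hNτ : N * τ ≤ 2 * k * |A ^ 2 + e ^ 2 - k ^ 2| := by
    rcases le_or_gt N (2 * k) with h4 | h4
    · gcongr
    · have := h2 h4
      nlinarith
  have hNτ' : N ≤ 2 * (k / τ) * |A ^ 2 + e ^ 2 - k ^ 2| := by
    rw [show 2 * (k / τ) * |A ^ 2 + e ^ 2 - k ^ 2| = 2 * k * |A ^ 2 + e ^ 2 - k ^ 2| / τ by ring,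
      le_div_iff₀ hτ]
    exact hNτ
  calc _ ≤ _ := hup
    _ ≤ (3 * N * |t|) * ((n + 1 : ℕ) : ℝ) * (4 * N ^ 2) ^ n := by
        gcongr
        exact max_le hxN' (by nlinarith)
    _ = (3 * (n + 1) * 4 ^ n * |t|) * N * (N ^ 2) ^ n := by
        rw [mul_pow]; push_cast; ring
    _ ≤ (3 * (n + 1) * 4 ^ n * |t|) * (2 * (k / τ) * |A ^ 2 + e ^ 2 - k ^ 2|) * (N ^ 2) ^ n := by
        gcongr
    _ = (6 * (n + 1) * 4 ^ n * (k / τ) * |t|) * (|A ^ 2 + e ^ 2 - k ^ 2| * (N ^ 2) ^ n) := by ring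
    _ ≤ _ := by gcongr

theorem mul_pow_le_abs_pow_sub (n : ℕ) (h : τ ≤ |A ^ 2 + e ^ 2 - k ^ 2|) :
    τ * (k ^ 2) ^ n ≤ |(A ^ 2 + e ^ 2) ^ (n + 1) - (k ^ 2) ^ (n + 1)| := by
  refine le_trans ?_ (abs_sub_mul_pow_le n (A ^ 2 + e ^ 2) (k ^ 2) (by positivity) (sq_nonneg k))
  gcongr
  exact le_max_right _ _

end RealEstimates

section Core

/-- Existence and uniqueness of the radius, for a bounded symmetric perturbation of a diagonal
operator. -/
theorem exists_unique_radius {ι : Type*} [DecidableEq ι] (o : ι)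
    (T : ℓ²(ι, ℂ) →L[ℂ] ℓ²(ι, ℂ)) (hsym : ∀ f g, inner ℂ (T f) g = inner ℂ f (T g))
    (C : ℝ) (hC : 0 < C) (hT : ‖T‖ ≤ C) (hTo : T (lp.single 2 o 1) o = 0)
    (n : ℕ) (k τ ρ : ℝ) (hk : 1 ≤ k) (hτ : 0 < τ) (hτ1 : τ ≤ 1) (hρ : 0 < ρ)
    (hρτ : 6 * k * ρ ≤ τ) (c e : ι → ℝ) (hco : c o = 0) (heo : e o = 0)
    (hgap : ∀ m, m ≠ o → 2 * τ < |(k + c m) ^ 2 + e m ^ 2 - k ^ 2|)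
    (hR : 2 * C ≤ τ * (k ^ 2) ^ n)
    (hη : 6 * (n + 1) * 4 ^ n * (k / τ) * (2 * C / (τ * (k ^ 2) ^ n) * (C * 2)) <
      (k / 2) ^ (2 * n + 1))
    (hε : C * (2 * C / (τ * (k ^ 2) ^ n)) < ρ * k ^ (2 * n + 1)) :
    ∃ κ ∈ Icc (k - ρ) (k + ρ),
      (∃ g : ℓ²(ι, ℂ), g ≠ 0 ∧ ∀ m,
        (((((κ + c m) ^ 2 + e m ^ 2) ^ (n + 1) - (k ^ 2) ^ (n + 1) : ℝ) : ℂ)) * g m + T g m = 0) ∧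
      |κ - k| * k ^ (2 * n + 1) ≤ C * (2 * C / (τ * (k ^ 2) ^ n)) ∧
      ∀ κ' ∈ Icc (k - ρ) (k + ρ), ∀ g : ℓ²(ι, ℂ), g ≠ 0 →
        (∀ m, (((((κ' + c m) ^ 2 + e m ^ 2) ^ (n + 1) - (k ^ 2) ^ (n + 1) : ℝ) : ℂ)) * g m
          + T g m = 0) → κ' = κ := by
  set R := τ * (k ^ 2) ^ n with hRdef
  set I := Icc (k - ρ) (k + ρ) with hI
  have hRpos : 0 < R := by positivity
  have hρ1 : 6 * ρ ≤ 1 := by nlinarith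
  let D : ℝ → ι → ℝ := fun κ m => ((κ + c m) ^ 2 + e m ^ 2) ^ (n + 1) - (k ^ 2) ^ (n + 1)
  have hshift : ∀ κ ∈ I, ∀ m, m ≠ o → τ ≤ |(κ + c m) ^ 2 + e m ^ 2 - k ^ 2| := by
    intro κ hκ m hm
    have hκ' : |κ - k| ≤ ρ := abs_le.mpr ⟨by linarith [hκ.1], by linarith [hκ.2]⟩
    have ht : 6 * k * |κ - k| ≤ τ := le_trans (by gcongr) hρτ
    have := le_abs_shift hk hτ1 ht (hgap m hm)
    rwa [show k + c m + (κ - k) = κ + c m by ring] at this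
  have hDlow : ∀ κ ∈ I, ∀ m, m ≠ o → R ≤ |D κ m| := fun κ hκ m hm =>
    mul_pow_le_abs_pow_sub n (hshift κ hκ m hm)
  have hDlip : ∀ κ ∈ I, ∀ κ' ∈ I, ∀ m, m ≠ o →
      |D κ' m - D κ m| ≤ (6 * (n + 1) * 4 ^ n * (k / τ) * |κ' - κ|) * |D κ m| := by
    intro κ hκ κ' hκ' m hm
    have ht : |κ' - κ| ≤ 1 :=
      abs_le.mpr ⟨by linarith [hκ.2, hκ'.1], by linarith [hκ.1, hκ'.2]⟩
    have := abs_pow_shift_sub_le n hk hτ hτ1 ht (hshift κ hκ m hm)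
    rw [show κ + c m + (κ' - κ) = κ' + c m by ring] at this
    simpa [D] using this
  have hex := fun κ (hκ : κ ∈ I) => exists_reduced_solution T o C R hC hT hR (D κ) (hDlow κ hκ)
  choose! F hFo hFeq hFn hFe hFuniq using hex
  have hTF : ∀ κ ∈ I, ‖T (F κ)‖ ≤ C * 2 := fun κ hκ =>
    (T.le_opNorm _).trans (by gcongr; exact hFn κ hκ)
  have hcmp : ∀ κ ∈ I, ∀ κ' ∈ I, ‖T (F κ) o - conj (T (F κ') o)‖ ≤
      6 * (n + 1) * 4 ^ n * (k / τ) * |κ' - κ| * (2 * C / R * (C * 2)) := by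
    intro κ hκ κ' hκ'
    refine (norm_residual_sub_le T o hsym (D κ) (D κ') (F κ) (F κ') (hFo κ hκ) (hFo κ' hκ')
      (hFeq κ hκ) (hFeq κ' hκ') (6 * (n + 1) * 4 ^ n * (k / τ) * |κ' - κ|) (by positivity)
      (hDlip κ hκ κ' hκ')).trans ?_
    gcongr
    · exact hFe κ' hκ'
    · exact hTF κ hκ
  have hreal : ∀ κ ∈ I, T (F κ) o = ((T (F κ) o).re : ℂ) := by
    intro κ hκ
    have h := hcmp κ hκ κ hκ
    rw [sub_self, abs_zero, mul_zero, zero_mul] at h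
    have h2 := sub_eq_zero.mp (norm_le_zero_iff.mp h)
    exact (Complex.conj_eq_iff_re.mp h2.symm).symm
  have hDo : ∀ κ, D κ o = κ ^ (2 * n + 1 + 1) - k ^ (2 * n + 1 + 1) := by
    intro κ
    simp only [D, hco, heo]
    rw [show 2 * n + 1 + 1 = 2 * (n + 1) by ring, pow_mul, pow_mul]
    ring
  obtain ⟨κ, hκ, hroot, hclose, huniq⟩ := exists_unique_perturbed_root (2 * n + 1) k ρ
    (6 * (n + 1) * 4 ^ n * (k / τ) * (2 * C / R * (C * 2))) (C * (2 * C / R)) hρ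
    (by linarith) (fun κ => (T (F κ) o).re)
    (fun x hx y hy => by
      have h := hcmp x hx y hy
      rw [hreal x hx, hreal y hy, Complex.conj_ofReal, ← Complex.ofReal_sub, Complex.norm_real,
        Real.norm_eq_abs, abs_sub_comm y x] at h
      exact h.trans (le_of_eq (by ring)))
    hη
    (fun x hx => by
      have h1 : T (F x) o = T (F x - lp.single 2 o 1) o := by
        rw [map_sub]
        change _ = T (F x) o - T (lp.single 2 o 1) o
        rw [hTo, sub_zero]
      rw [h1]
      refine (Complex.abs_re_le_norm _).trans ((lp.norm_apply_le_norm (by norm_num) _ o).trans ?_)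
      refine (T.le_opNorm _).trans ?_
      gcongr
      exact hFe x hx)
    hε
  refine ⟨κ, hκ, ⟨F κ, ?_, ?_⟩, hclose, ?_⟩
  · intro h
    have := hFo κ hκ
    rw [h] at this
    exact zero_ne_one this
  · intro m
    by_cases hm : m = o
    · subst hm
      change (D κ m : ℂ) * F κ m + T (F κ) m = 0
      rw [hFo κ hκ, hreal κ hκ, hDo, mul_one, ← Complex.ofReal_add]
      exact_mod_cast hroot
    · exact hFeq κ hκ m hm
  · intro κ' hκ' g hg hgeq
    refine huniq κ' hκ' ?_
    have h1 := hFuniq κ' hκ' g (fun m _ => hgeq m)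
    have hgo : g o ≠ 0 := by
      intro h0
      rw [h0, zero_smul] at h1
      exact hg h1
    have h2 : (D κ' o : ℂ) * g o + T g o = 0 := hgeq o
    have h3 : T g o = g o * T (F κ') o := by
      conv_lhs => rw [h1, map_smul]
      rfl
    rw [h3, hreal κ' hκ', hDo] at h2
    have h4 : g o * (((κ' ^ (2 * n + 1 + 1) - k ^ (2 * n + 1 + 1) + (T (F κ') o).re : ℝ)) : ℂ)
        = 0 := by
      rw [← h2, Complex.ofReal_add]; ring
    exact Complex.ofReal_eq_zero.mp ((mul_eq_zero.mp h4).resolve_left hgo)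

end Core

section Main

theorem isEigenvalue_iff (pw : ℤ × ℤ → ℝ) (M : ℤ × ℤ → ℂ) (lam : ℝ)
    (T : ℓ²(ℤ × ℤ, ℂ) →L[ℂ] ℓ²(ℤ × ℤ, ℂ))
    (hT : ∀ f m, HasSum (fun q => M (m - q) * f q) (T f m)) :
    IsEigenvalue (fun m => (pw m : ℂ)) M lam ↔
      ∃ g : ℓ²(ℤ × ℤ, ℂ), g ≠ 0 ∧ ∀ m, ((pw m - lam : ℝ) : ℂ) * g m + T g m = 0 := by
  constructor
  · rintro ⟨f, ⟨hf, -, heq⟩, hne⟩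
    let g : ℓ²(ℤ × ℤ, ℂ) := ⟨f, hf⟩
    refine ⟨g, fun h => hne ?_, fun m => ?_⟩
    · ext m
      exact congrArg (fun u : ℓ²(ℤ × ℤ, ℂ) => u m) h
    · have h1 := heq m
      have h2 : ∑' q, M (m - q) * f q = T g m := (hT g m).tsum_eq
      rw [h2] at h1
      change ((pw m - lam : ℝ) : ℂ) * f m + T g m = 0
      push_cast
      linear_combination h1
  · rintro ⟨g, hne, heq⟩
    refine ⟨g, ⟨lp.memℓp g, fun m => (hT g m).summable.norm, fun m => ?_⟩, fun h => hne ?_⟩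
    · rw [(hT g m).tsum_eq]
      have := heq m
      push_cast at this
      linear_combination this
    · exact lp.ext h

theorem sq2_smul_add (ν p : ℝ × ℝ) (hν : sq2 ν = 1) (κ : ℝ) :
    sq2 (κ • ν + p) =
      (κ + (ν.1 * p.1 + ν.2 * p.2)) ^ 2 + (ν.1 * p.2 - ν.2 * p.1) ^ 2 := by
  simp only [sq2, Prod.fst_add, Prod.snd_add, Prod.smul_fst, Prod.smul_snd, smul_eq_mul] at hν ⊢
  linear_combination (κ ^ 2 - p.1 ^ 2 - p.2 ^ 2) * hν

end Main

/-- Lemma 2.12: unique radius of the isoenergetic curve in nonresonant directions. -/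
theorem statement3 (l : ℕ) (hl : 6 ≤ l) (δ b₁ b₂ C_W : ℝ)
    (hδ : 0 < δ) (hδ' : 2 * δ < 2 * (l : ℝ) - 2 - 4 * s1 l)
    (hb₁ : 0 < b₁) (hb₂ : 0 < b₂) :
    ∃ C : ℝ, 0 < C ∧
    ∃ k₀ : ℝ, ∀ k : ℝ, k₀ < k → 1 < k →
    ∀ a₁ a₂ : ℝ,
      k ^ s1 l * b₁ / 4 ≤ a₁ → a₁ ≤ k ^ s1 l * b₁ →
      k ^ s1 l * b₂ / 4 ≤ a₂ → a₂ ≤ k ^ s1 l * b₂ →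
    ∀ W : ℝ × ℝ → ℝ, Measurable W → (∀ x, |W x| ≤ C_W) →
      (∀ x, W (x + (a₁, 0)) = W x) → (∀ x, W (x + (0, a₂)) = W x) →
      (∫ x in Icc (0 : ℝ × ℝ) (a₁, a₂), W x) = 0 →
    ∀ w : ℤ × ℤ → ℂ, (∀ j, w j = fCoeff a₁ a₂ W j) → Memℓp w 2 →
    ∀ ν : ℝ × ℝ, sq2 ν = 1 →
      (∀ m : ℤ × ℤ, m ≠ 0 →
        2 * k ^ (-4 * s1 l - δ) < |sq2 (k • ν + pvec a₁ a₂ m) - k ^ 2|) →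
    ∀ α : ℝ, α ∈ Icc (0 : ℝ) 1 →
      ∃ κ : ℝ,
        κ ∈ Icc (k - k ^ (-1 - 4 * s1 l - 2 * δ)) (k + k ^ (-1 - 4 * s1 l - 2 * δ)) ∧
        IsEigenvalue (fun m => ((sq2 (κ • ν + pvec a₁ a₂ m) ^ l : ℝ) : ℂ))
          (fun q => (α : ℂ) * w q) ((k ^ (2 * (l : ℝ)) : ℝ) : ℂ) ∧
        |κ - k| ≤ C * k ^ (-1 - 4 * s1 l - 2 * gam0 l δ - δ) ∧
        ∀ κ' : ℝ,
          κ' ∈ Icc (k - k ^ (-1 - 4 * s1 l - 2 * δ)) (k + k ^ (-1 - 4 * s1 l - 2 * δ)) →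
          IsEigenvalue (fun m => ((sq2 (κ' • ν + pvec a₁ a₂ m) ^ l : ℝ) : ℂ))
            (fun q => (α : ℂ) * w q) ((k ^ (2 * (l : ℝ)) : ℝ) : ℂ) →
          κ' = κ := by
  have hs : 0 < s1 l := by
    have : (6 : ℝ) ≤ l := by exact_mod_cast hl
    unfold s1
    linarith
  obtain ⟨n, rfl⟩ : ∃ n, l = n + 1 := ⟨l - 1, by omega⟩
  set s := s1 (n + 1) with hs_def
  have hγ : 0 < gam0 (n + 1) δ := by
    unfold gam0
    linarith
  have hγ_eq : gam0 (n + 1) δ = 2 * n - 4 * s - 2 * δ := by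
    simp only [gam0, ← hs_def]
    push_cast
    ring
  set γ := gam0 (n + 1) δ with hγ_def
  set C₀ : ℝ := |C_W| + 1 with hC₀
  have hC₀pos : 0 < C₀ := by positivity
  set B : ℝ := 6 * (n + 1) * 4 ^ n * (2 * C₀ * (C₀ * 2)) * 2 ^ (2 * n + 1) with hB
  have hBpos : 0 < B := by positivity
  set K : ℝ := 2 * C₀ + B + 2 * C₀ ^ 2 + 6 with hK
  have hKpos : 0 < K := by positivity
  refine ⟨2 * C₀ ^ 2, by positivity, K ^ (1 / δ), ?_⟩
  intro k hkK hk a₁ a₂ ha₁ _ ha₂ _ W hWm hWb _ _ hW0 w hw _ ν hν hgap α hα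
  have hk0 : 0 < k := by linarith
  have hkδ : K < k ^ δ := by
    have h := Real.rpow_lt_rpow (by positivity) hkK hδ
    rwa [← Real.rpow_mul hKpos.le, one_div_mul_cancel hδ.ne', Real.rpow_one] at h
  have hks : 0 < k ^ s := Real.rpow_pos_of_pos hk0 _
  have ha₁' : 0 < a₁ := lt_of_lt_of_le (by positivity) ha₁
  have ha₂' : 0 < a₂ := lt_of_lt_of_le (by positivity) ha₂
  obtain ⟨T, hTn, hTs, hTsum, hTo⟩ :=
    exists_scaled_convolution a₁ a₂ ha₁' ha₂' W hWm C_W hWb hW0 α hα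
  rw [← funext hw] at hTsum
  replace hTn : ‖T‖ ≤ C₀ := by linarith [le_abs_self C_W]
  set τ := k ^ (-4 * s - δ) with hτ
  set ρ := k ^ (-1 - 4 * s - 2 * δ) with hρ
  have hkn : ∀ j : ℕ, k ^ j = k ^ (j : ℝ) := fun j => (Real.rpow_natCast k j).symm
  have hτpos : 0 < τ := Real.rpow_pos_of_pos hk0 _
  have hρpos : 0 < ρ := Real.rpow_pos_of_pos hk0 _
  have hRe : τ * (k ^ 2) ^ n = k ^ (γ + δ) := by
    rw [← pow_mul, hkn, hτ, ← Real.rpow_add hk0, hγ_eq]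
    congr 1
    push_cast
    ring
  have hRδ : k ^ δ ≤ k ^ (γ + δ) := Real.rpow_le_rpow_of_exponent_le hk.le (by linarith)
  have hρk : ρ * k ^ (2 * n + 1) = k ^ γ := by
    rw [hkn, hρ, ← Real.rpow_add hk0, hγ_eq]
    congr 1
    push_cast
    ring
  have hγ1 : 1 ≤ k ^ γ := Real.one_le_rpow hk.le hγ.le
  set R := k ^ (γ + δ) with hR
  have hRK : K < R := hkδ.trans_le hRδ
  have hRpos : 0 < R := hKpos.trans hRK
  have hkτ : k / τ = k ^ (2 * n + 1) / R := by
    rw [← hRe, div_eq_div_iff hτpos.ne' (by positivity)]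
    ring
  have hcore := exists_unique_radius (0 : ℤ × ℤ) T hTs C₀ hC₀pos hTn hTo n k τ ρ hk.le hτpos
    (Real.rpow_le_one_of_one_le_of_nonpos hk.le (by linarith)) hρpos
    (by
      have h1 : τ = k * ρ * k ^ δ := by
        rw [hτ, hρ]
        nth_rewrite 2 [← Real.rpow_one k]
        rw [← Real.rpow_add hk0, ← Real.rpow_add hk0]
        congr 1
        ring
      have h2 : k * ρ * 6 ≤ k * ρ * k ^ δ := by
        gcongr
        have : 0 < C₀ ^ 2 := by positivity
        linarith
      linarith)
    (fun m => ν.1 * (pvec a₁ a₂ m).1 + ν.2 * (pvec a₁ a₂ m).2)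
    (fun m => ν.1 * (pvec a₁ a₂ m).2 - ν.2 * (pvec a₁ a₂ m).1)
    (by simp [pvec]) (by simp [pvec])
    (fun m hm => by
      have := hgap m hm
      rwa [sq2_smul_add ν _ hν] at this)
    (by
      rw [hRe]
      have : 0 < C₀ ^ 2 := by positivity
      linarith)
    (by
      rw [hRe, hkτ, div_pow, lt_div_iff₀ (by positivity)]
      have h1 : 6 * ((n : ℝ) + 1) * 4 ^ n * (k ^ (2 * n + 1) / R) * (2 * C₀ / R * (C₀ * 2)) *
          2 ^ (2 * n + 1) = k ^ (2 * n + 1) * (B / (R * R)) := by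
        rw [hB]
        field_simp
      rw [h1]
      have h2 : B / (R * R) < 1 := by
        rw [div_lt_one (by positivity)]
        have : 0 < C₀ ^ 2 := by positivity
        nlinarith
      exact mul_lt_of_lt_one_right (by positivity) h2)
    (by
      rw [hRe, hρk]
      have h1 : C₀ * (2 * C₀ / R) < 1 := by
        rw [show C₀ * (2 * C₀ / R) = 2 * C₀ ^ 2 / R by ring, div_lt_one hRpos]
        linarith
      linarith)
  have hlam : k ^ (2 * ((n + 1 : ℕ) : ℝ)) = (k ^ 2) ^ (n + 1) := by
    rw [← pow_mul, hkn]
    push_cast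
    rfl
  have heig : ∀ κ : ℝ, IsEigenvalue
      (fun m => ((sq2 (κ • ν + pvec a₁ a₂ m) ^ (n + 1) : ℝ) : ℂ))
      (fun q => (α : ℂ) * w q) ((k ^ (2 * ((n + 1 : ℕ) : ℝ)) : ℝ) : ℂ) ↔ _ := fun κ =>
    isEigenvalue_iff (fun m => sq2 (κ • ν + pvec a₁ a₂ m) ^ (n + 1)) _ _ T hTsum
  simp only [sq2_smul_add ν _ hν, hlam] at heig
  obtain ⟨κ, hκ, hex, hclose, huniq⟩ := hcore
  refine ⟨κ, hκ, ?_, ?_, ?_⟩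
  · simp only [sq2_smul_add ν _ hν, hlam]
    exact (heig κ).mpr hex
  · rw [hRe] at hclose
    have hkp : 0 < k ^ (2 * n + 1) := by positivity
    calc |κ - k| ≤ C₀ * (2 * C₀ / R) / k ^ (2 * n + 1) := (le_div_iff₀ hkp).mpr hclose
      _ = 2 * C₀ ^ 2 * k ^ (-(γ + δ) - ((2 * n + 1 : ℕ) : ℝ)) := by
        rw [Real.rpow_sub hk0, Real.rpow_neg hk0.le, ← hkn, ← hR]
        field_simp
      _ ≤ 2 * C₀ ^ 2 * k ^ (-1 - 4 * s - 2 * γ - δ) := by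
        refine mul_le_mul_of_nonneg_left (Real.rpow_le_rpow_of_exponent_le hk.le ?_)
          (by positivity)
        push_cast
        linarith
  · intro κ' hκ' h
    simp only [sq2_smul_add ν _ hν, hlam] at h
    obtain ⟨g, hg, hgeq⟩ := (heig κ').mp h
    exact huniq κ' hκ' g hg hgeq
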